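/- Let $T \in \mathfrak{P}_n$ and let $h$ be a completion of $T$ in the homeomorphism group of $\mathfrak{C}_n$. Let $g \in V_n$ and let $\{\eta_1,\dots,\eta_l\}$ and $\{\nu_1,\dots,\nu_l\}$ be maximal antichains such that $(\eta_i \delta)g = \nu_i \delta$ for all $\delta \in \mathfrak{C}_n$ and $1 \leq i \leq l$. Then the map $f$ defined by $\eta_i \delta \mapsto \nu_i (\delta)h$ is also a completion of $T$. -/

import Mathlib

open Classical

noncomputable section

/-- `n`-ary Cantor space: infinite words over the alphabet `Fin n`. -/
abbrev Cantor (n : ℕ) : Type := ℕ → Fin n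

/-- The finite word `w` is a prefix of the infinite word `χ`. -/
def PrefixOf {n : ℕ} (w : List (Fin n)) (χ : Cantor n) : Prop :=
  ∀ (i : ℕ) (h : i < w.length), w.get ⟨i, h⟩ = χ i

/-- Concatenation of a finite word with an infinite word. -/
def appendInf {n : ℕ} (w : List (Fin n)) (χ : Cantor n) : Cantor n :=
  fun i => if h : i < w.length then w.get ⟨i, h⟩ else χ (i - w.length)

/-- The cone (basic clopen set) of infinite words having the finite word `w` as prefix. -/
def cone {n : ℕ} (w : List (Fin n)) : Set (Cantor n) :=
  {χ | PrefixOf w χ}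

/-- The length-`k` prefix of an infinite word, as a finite word. -/
def takeW {n : ℕ} (χ : Cantor n) (k : ℕ) : List (Fin n) :=
  List.ofFn (fun i : Fin k => χ i)

/-- A finite family of finite words forming a maximal antichain:
every infinite word has exactly one member of the family as a prefix. -/
def AntichainFam {n m : ℕ} (α : Fin m → List (Fin n)) : Prop :=
  ∀ χ : Cantor n, ∃! i : Fin m, PrefixOf (α i) χ

/-- The group structure on self-homeomorphisms of a topological space,
with `f * g` acting as `g` followed by `f`. -/
instance homeoGroup {X : Type*} [TopologicalSpace X] : Group (X ≃ₜ X) where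
  mul f g := g.trans f
  one := Homeomorph.refl X
  inv := Homeomorph.symm
  mul_assoc a b c := Homeomorph.ext fun _ => rfl
  one_mul a := Homeomorph.ext fun _ => rfl
  mul_one a := Homeomorph.ext fun _ => rfl
  inv_mul_cancel a := Homeomorph.ext fun x => a.symm_apply_apply x

/-- The Higman–Thompson group `Vₙ`, as the set of self-homeomorphisms of Cantor space
which act by exchanging finite prefixes along a pair of maximal antichains. -/
def Vn (n : ℕ) : Set (Cantor n ≃ₜ Cantor n) :=
  {g | ∃ (m : ℕ) (α β : Fin m → List (Fin n)), AntichainFam α ∧ AntichainFam β ∧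
      ∀ (i : Fin m) (χ : Cantor n), g (appendInf (α i) χ) = appendInf (β i) χ}

/-- Conjugation in the paper's right-action convention: `paperConj g v = g⁻¹ v g`,
i.e. the homeomorphism `x ↦ (x) g⁻¹ v g` (first apply `g⁻¹`, then `v`, then `g`). -/
def paperConj {n : ℕ} (g v : Cantor n ≃ₜ Cantor n) : Cantor n ≃ₜ Cantor n :=
  (g.symm.trans v).trans g

/-- `l` is the longest common prefix of the set `A` of infinite words. -/
def IsLCP {n : ℕ} (A : Set (Cantor n)) (l : List (Fin n)) : Prop :=
  (∀ ρ ∈ A, PrefixOf l ρ) ∧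
    ∀ l' : List (Fin n), (∀ ρ ∈ A, PrefixOf l' ρ) → l'.length ≤ l.length

/-- A (not necessarily finite-state) transducer over the alphabet `Fin n`. -/
structure Transducer (n : ℕ) where
  /-- the set of states -/
  Q : Type
  /-- the transition function -/
  tr : Fin n → Q → Q
  /-- the output (rewrite) function -/
  out : Fin n → Q → List (Fin n)

namespace Transducer

variable {n : ℕ}

/-- The transition function extended to finite words. -/
def transStar (T : Transducer n) : List (Fin n) → T.Q → T.Q
  | [], q => q
  | x :: w, q => T.transStar w (T.tr x q)

/-- The output function extended to finite words. -/
def outStar (T : Transducer n) : List (Fin n) → T.Q → List (Fin n)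
  | [], _ => []
  | x :: w, q => T.out x q ++ T.outStar w (T.tr x q)

/-- The initial transducer `T_q` induces the map `f` on Cantor space: the outputs along
ever longer prefixes of `χ` are ever longer prefixes of `f χ`. -/
def Induces (T : Transducer n) (q : T.Q) (f : Cantor n → Cantor n) : Prop :=
  ∀ (χ : Cantor n) (m : ℕ), ∃ k : ℕ,
    m ≤ (T.outStar (takeW χ k) q).length ∧ PrefixOf (T.outStar (takeW χ k) q) (f χ)

/-- The image of the state `q`: the image of Cantor space under the map induced by `T_q`. -/
def stateImage (T : Transducer n) (q : T.Q) : Set (Cantor n) :=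
  {y | ∃ (f : Cantor n → Cantor n) (χ : Cantor n), T.Induces q f ∧ f χ = y}

/-- `T` is synchronizing at level `k`: the state reached after reading any word of
length `k` does not depend on the starting state. -/
def SyncAtLevel (T : Transducer n) (k : ℕ) : Prop :=
  ∀ w : List (Fin n), w.length = k → ∀ q q' : T.Q, T.transStar w q = T.transStar w q'

/-- `T` is synchronizing if it is synchronizing at some level. -/
def Synchronizing (T : Transducer n) : Prop := ∃ k, T.SyncAtLevel k

/-- `T` (inducing the homeomorphism `h` at `q0`) is one-way synchronizing: `T` is
synchronizing, but the inverse homeomorphism is not induced by any finite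
synchronizing transducer (equivalently, the inverse transducer is not synchronizing). -/
def OneWaySync (T : Transducer n) (q0 : T.Q) (h : Cantor n ≃ₜ Cantor n) : Prop :=
  T.Induces q0 ⇑h ∧ T.Synchronizing ∧
    ¬ ∃ (S : Transducer n) (_ : Finite S.Q) (s0 : S.Q),
        S.Induces s0 ⇑h.symm ∧ S.Synchronizing

/-- `T` is equal to its core : every state is reached by reading a word of length `k`
from some state, for every synchronizing level `k`. -/
def EqualToCore (T : Transducer n) : Prop :=
  ∀ k : ℕ, T.SyncAtLevel k → ∀ q : T.Q, ∃ (w : List (Fin n)) (p : T.Q),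
    w.length = k ∧ T.transStar w p = q

/-- Every state of `T` is accessible from `q0`. -/
def Accessible (T : Transducer n) (q0 : T.Q) : Prop :=
  ∀ q : T.Q, ∃ w : List (Fin n), T.transStar w q0 = q

/-- The product transducer `T S` (first act by `T`, then by `S`). -/
def prod (T S : Transducer n) : Transducer n where
  Q := T.Q × S.Q
  tr := fun x p => (T.tr x p.1, S.transStar (T.out x p.1) p.2)
  out := fun x p => S.outStar (T.out x p.1) p.2

/-- `T` is partially invertible: every state induces an injective map on Cantor space
with clopen image. -/
def PartiallyInvertible (T : Transducer n) : Prop :=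
  ∀ q : T.Q, ∃ f : Cantor n → Cantor n,
    T.Induces q f ∧ Function.Injective f ∧ IsClopen (Set.range f)

/-- `T` has no states of incomplete response: for each state `q` and letter `i`, no word
strictly longer than `λ(i,q)` is a common prefix of the outputs on all of the cone `[i]`. -/
def NoIncompleteResponse (T : Transducer n) : Prop :=
  ∀ (q : T.Q) (i x : Fin n),
    ¬ ∀ χ : Cantor n, ∃ k : ℕ, (T.out i q ++ [x]) <+: T.outStar (i :: takeW χ k) q

/-- States `q` of `T` and `p` of `S` are `ω`-equivalent: they induce one and the same
map on Cantor space. -/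
def OmegaEq (T : Transducer n) (q : T.Q) (S : Transducer n) (p : S.Q) : Prop :=
  ∃ f : Cantor n → Cantor n, T.Induces q f ∧ S.Induces p f

/-- `T` is minimal: no states of incomplete response and no pair of distinct
`ω`-equivalent states. -/
def Minimal (T : Transducer n) : Prop :=
  T.NoIncompleteResponse ∧ ∀ q q' : T.Q, T.OmegaEq q T q' → q = q'

/-- The map on Cantor space induced by the state `q` (junk value if none exists). -/
def inducedMap (T : Transducer n) (q : T.Q) : Cantor n → Cantor n :=
  if h : ∃ f, T.Induces q f then h.choose else id

/-- `𝓛_q(α)`: the longest common prefix of the preimage of the cone `[α]` under `T_q`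
(junk value if it does not exist). -/
def lcp (T : Transducer n) (q : T.Q) (α : List (Fin n)) : List (Fin n) :=
  if h : ∃ l, IsLCP {ρ : Cantor n | T.inducedMap q ρ ∈ cone α} l then h.choose else []

/-- The inverse transducer of `T` given by the inversion algorithm, on the set of all
pairs `(w, q)`: reading `x` from `(w,q)` outputs `𝓛_q(wx)` and moves to
`(wx - λ(𝓛_q(wx), q), π(𝓛_q(wx), q))`. -/
def invT (T : Transducer n) : Transducer n where
  Q := List (Fin n) × T.Q
  tr := fun x p =>
    ((p.1 ++ [x]).drop (T.outStar (T.lcp p.2 (p.1 ++ [x])) p.2).length,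
      T.transStar (T.lcp p.2 (p.1 ++ [x])) p.2)
  out := fun x p => T.lcp p.2 (p.1 ++ [x])

/-- Restriction of a transducer to a set of states (transitions leaving the set are
replaced by junk loops; for transition-closed sets this is the honest restriction). -/
def restrictTo (T : Transducer n) (P : T.Q → Prop) : Transducer n where
  Q := {q : T.Q // P q}
  tr := fun x q => if h : P (T.tr x q.1) then ⟨T.tr x q.1, h⟩ else q
  out := fun x q => T.out x q.1

/-- The set of states reachable from `q0`. -/
def reach (T : Transducer n) (q0 : T.Q) : T.Q → Prop :=
  fun q => ∃ w : List (Fin n), T.transStar w q0 = q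

/-- The inverse transducer of the initial transducer `T_{q0}`, with state set the states
accessible from `(ε, q0)`. -/
def invAcc (T : Transducer n) (q0 : T.Q) : Transducer n :=
  (T.invT).restrictTo ((T.invT).reach ([], q0))

/-- A pair `(w,p)` is good if `[w] ⊆ im(T_p)` and `𝓛_p(w) = ε`. -/
def GoodPair (T : Transducer n) (p : List (Fin n) × T.Q) : Prop :=
  cone p.1 ⊆ T.stateImage p.2 ∧
    IsLCP {ρ : Cantor n | T.inducedMap p.2 ρ ∈ cone p.1} []

/-- The partial inverse `T'` of a partially invertible transducer `T`: the inverse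
transducer restricted to the good pairs `(w,p)` with `[w] ⊆ im(T_p)`, `𝓛_p(w) = ε`. -/
def partialInv (T : Transducer n) : Transducer n :=
  (T.invT).restrictTo T.GoodPair

/-- `h` is a completion of `T`: there are a maximal antichain `η` and an effective viable
combination `(ρ, p)` such that `h` maps `η_i χ` to `ρ_i (χ)T_{p_i}`. -/
def IsCompletion (T : Transducer n) (h : Cantor n ≃ₜ Cantor n) : Prop :=
  ∃ (l : ℕ) (η ρ : Fin l → List (Fin n)) (p : Fin l → T.Q)
      (f : Fin l → (Cantor n → Cantor n)),
    l % (n - 1) = 1 % (n - 1) ∧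
    AntichainFam η ∧
    (∀ i, T.Induces (p i) (f i)) ∧
    (⋃ i, appendInf (ρ i) '' Set.range (f i)) = Set.univ ∧
    (∀ i j, i ≠ j →
      Disjoint (appendInf (ρ i) '' Set.range (f i))
        (appendInf (ρ j) '' Set.range (f j))) ∧
    ∀ (i : Fin l) (χ : Cantor n), h (appendInf (η i) χ) = appendInf (ρ i) (f i χ)

/-- The group `𝓗(T)` generated by all completions of `T`. -/
def HGroup (T : Transducer n) : Subgroup (Cantor n ≃ₜ Cantor n) :=
  Subgroup.closure {h | T.IsCompletion h}

/-- The subgroup-generating equivalence relation induced by the automaton underlying a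
transducer `A` with start state `a0` (by Lemma 4.1, two words are related iff the states
they reach are identified by the collapsing procedure, i.e. iff the reached states
transition identically on all sufficiently long words). -/
def simA (A : Transducer n) (a0 : A.Q) (α β : List (Fin n)) : Prop :=
  ∃ i : ℕ, ∀ w : List (Fin n), w.length = i →
    A.transStar w (A.transStar α a0) = A.transStar w (A.transStar β a0)

/-- `if b then T else T'`. -/
def factor (T : Transducer n) (b : Bool) : Transducer n :=
  if b then T else T.partialInv

/-- The product of a nonempty list of factors, each equal to `T` or its partial
inverse `T'`; these products make up the set `Π(T)`. -/
def prodOf (T : Transducer n) : List Bool → Transducer n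
  | [] => T
  | [b] => T.factor b
  | b :: c :: rest => (T.factor b).prod (T.prodOf (c :: rest))

/-- `T` is contracting: every state of every product of copies of `T` and `T'` is
`ω`-equivalent to an initial transducer which, after reading some fixed length of input,
always acts as a state of `T`. -/
def Contracting (T : Transducer n) : Prop :=
  ∀ L : List Bool, L ≠ [] → ∀ q : (T.prodOf L).Q,
    ∃ (V : Transducer n) (p : V.Q) (f : Cantor n → Cantor n),
      (T.prodOf L).Induces q f ∧ V.Induces p f ∧
      ∃ j : ℕ, ∀ w : List (Fin n), w.length = j →
        ∃ (u : T.Q) (g : Cantor n → Cantor n),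
          V.Induces (V.transStar w p) g ∧ T.Induces u g

end Transducer

/-- The element `v` of `Vₙ` preserves the relation `r` on nonempty finite words:
whenever `v` replaces the prefix `α` by `β`, the words `α` and `β` are related. -/
def PreservesRel {n : ℕ} (r : List (Fin n) → List (Fin n) → Prop)
    (g : Cantor n ≃ₜ Cantor n) : Prop :=
  ∀ (α β : List (Fin n)), α ≠ [] → β ≠ [] →
    (∀ χ : Cantor n, g (appendInf α χ) = appendInf β χ) → r α β

/-- The subgroup `V_∼` of `Vₙ` generated by the prefix-exchange homeomorphisms
preserving the relation `r`. -/
def VSim (n : ℕ) (r : List (Fin n) → List (Fin n) → Prop) :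
    Subgroup (Cantor n ≃ₜ Cantor n) :=
  Subgroup.closure {g | g ∈ Vn n ∧ PreservesRel r g}

/-- `f` coincides with `g` on the cone `[α]` (conjugated into the cone) and is the
identity off the cone: the homeomorphism `[α]_g`. -/
def IsRestrTo {n : ℕ} (α : List (Fin n)) (g f : Cantor n ≃ₜ Cantor n) : Prop :=
  (∀ χ : Cantor n, f (appendInf α χ) = appendInf α (g χ)) ∧
  ∀ χ : Cantor n, ¬ PrefixOf α χ → f χ = χ

/-- The Nekrashevych group `Vₙ(G)`: the group generated by `Vₙ` together with all the
homeomorphisms `[α]_g` for `g ∈ G`. -/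
def NekG (n : ℕ) (G : Subgroup (Cantor n ≃ₜ Cantor n)) :
    Subgroup (Cantor n ≃ₜ Cantor n) :=
  Subgroup.closure (Vn n ∪ {f | ∃ (α : List (Fin n)) (g : Cantor n ≃ₜ Cantor n),
    g ∈ G ∧ IsRestrTo α g f})

/-- The homeomorphism `f` locally agrees with the set `G` of homeomorphisms. -/
def LocallyAgrees {n : ℕ} (G : Set (Cantor n ≃ₜ Cantor n))
    (f : Cantor n ≃ₜ Cantor n) : Prop :=
  ∀ x : Cantor n, ∃ U : Set (Cantor n), IsOpen U ∧ x ∈ U ∧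
    ∃ g ∈ G, Set.EqOn ⇑f ⇑g U

/-- A finite synchronous invertible transducer over `Fin n`: each state rewrites single
letters to single letters bijectively. -/
structure SyncTransducer (n : ℕ) where
  /-- the set of states -/
  Q : Type
  /-- there are finitely many states -/
  fin : Finite Q
  /-- the transition function -/
  tr : Fin n → Q → Q
  /-- the (single-letter) output function -/
  out : Fin n → Q → Fin n
  /-- each state rewrites letters bijectively -/
  bij : ∀ q : Q, Function.Bijective fun x => out x q

namespace SyncTransducer

variable {n : ℕ}

/-- The transition function extended to finite words. -/
def trStar (U : SyncTransducer n) : List (Fin n) → U.Q → U.Q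
  | [], q => q
  | x :: w, q => U.trStar w (U.tr x q)

/-- The output function extended to finite words. -/
def outWord (U : SyncTransducer n) : List (Fin n) → U.Q → List (Fin n)
  | [], _ => []
  | x :: w, q => U.out x q :: U.outWord w (U.tr x q)

/-- The map on Cantor space induced by the initial transducer `U_q`. -/
def applyFun (U : SyncTransducer n) (q : U.Q) (χ : Cantor n) : Cantor n :=
  fun i => U.out (χ i) (U.trStar (takeW χ i) q)

/-- The inverse transducer of a synchronous invertible transducer. -/
def inv (U : SyncTransducer n) : SyncTransducer n where
  Q := U.Q
  fin := U.fin
  tr := fun y q => U.tr ((Equiv.ofBijective _ (U.bij q)).symm y) q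
  out := fun y q => (Equiv.ofBijective _ (U.bij q)).symm y
  bij := fun q => (Equiv.ofBijective _ (U.bij q)).symm.bijective

/-- The product of synchronous transducers (first act by `T`, then by `S`). -/
def sprod (T S : SyncTransducer n) : SyncTransducer n where
  Q := T.Q × S.Q
  fin := by
    haveI := T.fin; haveI := S.fin
    infer_instance
  tr := fun x p => (T.tr x p.1, S.tr (T.out x p.1) p.2)
  out := fun x p => S.out (T.out x p.1) p.2
  bij := fun p => (S.bij p.2).comp (T.bij p.1)

/-- `U` is synchronizing at level `k`. -/
def SyncAtLevel (U : SyncTransducer n) (k : ℕ) : Prop :=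
  ∀ w : List (Fin n), w.length = k → ∀ q q' : U.Q, U.trStar w q = U.trStar w q'

/-- `U` is synchronizing. -/
def Synchronizing (U : SyncTransducer n) : Prop := ∃ k, U.SyncAtLevel k

/-- `U` is minimal (under `ω`-equivalence): distinct states induce distinct maps. -/
def Minimal (U : SyncTransducer n) : Prop :=
  ∀ q q' : U.Q, U.applyFun q = U.applyFun q' → q = q'

/-- One-way synchronizing: `U` is synchronizing but the inverse homeomorphism of
`h = U_{q0}` is not induced by any finite synchronizing transducer. -/
def OneWaySync (U : SyncTransducer n) (h : Cantor n ≃ₜ Cantor n) : Prop :=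
  U.Synchronizing ∧
    ¬ ∃ (S : Transducer n) (_ : Finite S.Q) (s0 : S.Q),
        S.Induces s0 ⇑h.symm ∧ S.Synchronizing

/-- `U` is equal to its core. -/
def EqualToCore (U : SyncTransducer n) : Prop :=
  ∀ k : ℕ, U.SyncAtLevel k → ∀ q : U.Q, ∃ (w : List (Fin n)) (p : U.Q),
    w.length = k ∧ U.trStar w p = q

/-- The underlying (asynchronous-format) transducer of a synchronous transducer. -/
def toT (U : SyncTransducer n) : Transducer n :=
  ⟨U.Q, U.tr, fun x q => [U.out x q]⟩

/-- The automaton group `𝒢(U)` generated by `U`: the subgroup of the homeomorphism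
group of Cantor space generated by the homeomorphisms `U_q` for the states `q`. -/
def autG (U : SyncTransducer n) : Subgroup (Cantor n ≃ₜ Cantor n) :=
  Subgroup.closure {f : Cantor n ≃ₜ Cantor n | ∃ q : U.Q, ⇑f = U.applyFun q}

end SyncTransducer

section PrefixReplacement

variable {n : ℕ}

/-- The infinite word obtained by deleting the first `k` letters. -/
def dropInf (k : ℕ) (χ : Cantor n) : Cantor n := fun i => χ (i + k)

theorem prefixOf_appendInf (w : List (Fin n)) (χ : Cantor n) :
    PrefixOf w (appendInf w χ) := by
  intro i hi
  simp [appendInf, hi]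

theorem dropInf_appendInf (w : List (Fin n)) (χ : Cantor n) :
    dropInf w.length (appendInf w χ) = χ := by
  funext i
  simp [dropInf, appendInf]

theorem appendInf_dropInf {w : List (Fin n)} {χ : Cantor n} (hw : PrefixOf w χ) :
    appendInf w (dropInf w.length χ) = χ := by
  funext i
  by_cases hi : i < w.length
  · simpa [appendInf, hi] using hw i hi
  · simp [appendInf, dropInf, hi, Nat.sub_add_cancel (not_lt.mp hi)]

theorem appendInf_injective (w : List (Fin n)) : Function.Injective (appendInf w) :=
  Function.LeftInverse.injective (g := dropInf w.length) (dropInf_appendInf w)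

theorem appendInf_append (a b : List (Fin n)) (χ : Cantor n) :
    appendInf (a ++ b) χ = appendInf a (appendInf b χ) := by
  funext i
  by_cases h1 : i < a.length
  · simp [appendInf, h1, Nat.lt_add_right b.length h1]
  · have h2 : i < a.length + b.length ↔ i - a.length < b.length := by omega
    simp [appendInf, h1, List.getElem_append, h2, Nat.sub_sub]

theorem prefixOf_append_iff (a b : List (Fin n)) (χ : Cantor n) :
    PrefixOf (a ++ b) χ ↔ PrefixOf a χ ∧ PrefixOf b (dropInf a.length χ) := by
  constructor
  · intro h
    have e := appendInf_dropInf h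
    rw [appendInf_append] at e
    rw [← e, dropInf_appendInf]
    exact ⟨prefixOf_appendInf _ _, prefixOf_appendInf _ _⟩
  · rintro ⟨ha, hb⟩
    rw [← appendInf_dropInf ha, ← appendInf_dropInf hb, ← appendInf_append]
    exact prefixOf_appendInf _ _

theorem continuous_dropInf (k : ℕ) : Continuous (dropInf k : Cantor n → Cantor n) :=
  continuous_pi fun i => continuous_apply (i + k)

theorem continuous_appendInf (w : List (Fin n)) : Continuous (appendInf w) := by
  refine continuous_pi fun i => ?_
  by_cases hi : i < w.length
  · simpa [appendInf, hi] using continuous_const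
  · simpa [appendInf, hi] using continuous_apply (i - w.length)

theorem isOpen_cone (w : List (Fin n)) : IsOpen (cone w) := by
  have : cone w = ⋂ i : Fin w.length, {χ : Cantor n | w.get i = χ i} := by
    ext χ
    simp only [cone, PrefixOf, Set.mem_ofPred_eq, Set.mem_iInter]
    exact ⟨fun h i => h i i.2, fun h i hi => h ⟨i, hi⟩⟩
  rw [this]
  refine isOpen_iInter_of_finite fun i => ?_
  exact (isOpen_discrete {a : Fin n | w.get i = a}).preimage
    (continuous_apply (A := fun _ : ℕ => Fin n) (i : ℕ))

namespace AntichainFam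

variable {m : ℕ} {α β : Fin m → List (Fin n)}

/-- The index of the member of a maximal antichain which is a prefix of an infinite word. -/
def index (hα : AntichainFam α) (χ : Cantor n) : Fin m := (hα χ).choose

theorem prefixOf_index (hα : AntichainFam α) (χ : Cantor n) :
    PrefixOf (α (hα.index χ)) χ := (hα χ).choose_spec.1

theorem index_eq (hα : AntichainFam α) {χ : Cantor n} {i : Fin m} (hi : PrefixOf (α i) χ) :
    hα.index χ = i := ((hα χ).choose_spec.2 i hi).symm

/-- The map `α i δ ↦ β i (δ)φ`. -/
def replace (hα : AntichainFam α) (β : Fin m → List (Fin n)) (φ : Cantor n → Cantor n) :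
    Cantor n → Cantor n :=
  fun χ => appendInf (β (hα.index χ)) (φ (dropInf (α (hα.index χ)).length χ))

theorem replace_of_prefixOf (hα : AntichainFam α) (φ : Cantor n → Cantor n) {i : Fin m}
    {χ : Cantor n} (hi : PrefixOf (α i) χ) :
    hα.replace β φ χ = appendInf (β i) (φ (dropInf (α i).length χ)) := by
  rw [replace, hα.index_eq hi]

theorem replace_appendInf (hα : AntichainFam α) (φ : Cantor n → Cantor n) (i : Fin m)
    (χ : Cantor n) : hα.replace β φ (appendInf (α i) χ) = appendInf (β i) (φ χ) := by
  rw [hα.replace_of_prefixOf φ (prefixOf_appendInf _ _), dropInf_appendInf]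

theorem continuous_replace (hα : AntichainFam α) {φ : Cantor n → Cantor n}
    (hφ : Continuous φ) : Continuous (hα.replace β φ) := by
  refine continuous_iff_continuousAt.mpr fun χ => ?_
  have hc : Continuous fun ψ => appendInf (β (hα.index χ))
      (φ (dropInf (α (hα.index χ)).length ψ)) :=
    (continuous_appendInf _).comp (hφ.comp (continuous_dropInf _))
  refine hc.continuousAt.congr ?_
  filter_upwards [(isOpen_cone _).mem_nhds (hα.prefixOf_index χ)] with ψ hψ
  exact (hα.replace_of_prefixOf φ hψ).symm

theorem replace_replace (hα : AntichainFam α) (hβ : AntichainFam β)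
    {φ ψ : Cantor n → Cantor n} (h : Function.LeftInverse ψ φ) :
    Function.LeftInverse (hβ.replace α ψ) (hα.replace β φ) := by
  intro χ
  rw [← appendInf_dropInf (hα.prefixOf_index χ), replace_appendInf, replace_appendInf, h]

/-- The homeomorphism `α i δ ↦ β i (δ)h`. -/
def replaceHomeomorph (hα : AntichainFam α) (hβ : AntichainFam β) (h : Cantor n ≃ₜ Cantor n) :
    Cantor n ≃ₜ Cantor n where
  toFun := hα.replace β h
  invFun := hβ.replace α h.symm
  left_inv := hα.replace_replace hβ h.symm_apply_apply
  right_inv := hβ.replace_replace hα h.apply_symm_apply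
  continuous_toFun := hα.continuous_replace h.continuous
  continuous_invFun := hβ.continuous_replace h.symm.continuous

theorem append {k : ℕ} {γ : Fin k → List (Fin n)} (hα : AntichainFam α)
    (hγ : AntichainFam γ) :
    AntichainFam fun s : Fin (m * k) =>
      α (finProdFinEquiv.symm s).1 ++ γ (finProdFinEquiv.symm s).2 := by
  intro χ
  obtain ⟨i, hi, hi'⟩ := hα χ
  obtain ⟨j, hj, hj'⟩ := hγ (dropInf (α i).length χ)
  refine ⟨finProdFinEquiv (i, j), ?_, fun s hs => ?_⟩
  · simpa only [Equiv.symm_apply_apply, prefixOf_append_iff] using ⟨hi, hj⟩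
  · obtain ⟨⟨a, b⟩, rfl⟩ := finProdFinEquiv.surjective s
    simp only [Equiv.symm_apply_apply, prefixOf_append_iff] at hs
    obtain rfl := hi' a hs.1
    obtain rfl := hj' b hs.2
    rfl

/-- The number of words of length `N` extending a given word of length at most `N` is `1`
modulo `n - 1`. -/
theorem card_extensions_modEq (hn : 2 ≤ n) (N : ℕ) (w : List (Fin n)) :
    (Finset.univ.filter fun v : Fin N → Fin n =>
      ∀ i : Fin N, ∀ hi : (i : ℕ) < w.length, v i = w.get ⟨i, hi⟩).card ≡ 1 [MOD n - 1] := by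
  have hn1 : n ≡ 1 [MOD n - 1] := by
    have := Nat.add_modEq_left (n := n - 1) (a := 1)
    rwa [Nat.sub_add_cancel (by omega)] at this
  have hset : (Finset.univ.filter fun v : Fin N → Fin n =>
      ∀ i : Fin N, ∀ hi : (i : ℕ) < w.length, v i = w.get ⟨i, hi⟩) =
      Fintype.piFinset fun i : Fin N =>
        if hi : (i : ℕ) < w.length then {w.get ⟨i, hi⟩} else Finset.univ := by
    ext v
    simp only [Finset.mem_filter, Finset.mem_univ, true_and, Fintype.mem_piFinset]
    refine forall_congr' fun i => ?_
    by_cases hi : (i : ℕ) < w.length <;> simp [hi]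
  rw [hset, Fintype.card_piFinset]
  refine Finset.prod_induction _ (· ≡ 1 [MOD n - 1]) (fun a b ha hb => ha.mul hb) rfl ?_
  intro i _
  by_cases hi : (i : ℕ) < w.length
  · simp only [hi, dite_true, Finset.card_singleton]; rfl
  · simpa [hi] using hn1

/-- A finite maximal antichain has cardinality `1` modulo `n - 1`. -/
theorem card_modEq_one (hn : 2 ≤ n) (hα : AntichainFam α) : m ≡ 1 [MOD n - 1] := by
  let N := Finset.univ.sup fun i => (α i).length
  have hN : ∀ i, (α i).length ≤ N := fun i =>
    Finset.le_sup (f := fun i => (α i).length) (Finset.mem_univ i)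
  let ext : (Fin N → Fin n) → Cantor n := fun v i =>
    if hi : i < N then v ⟨i, hi⟩ else ⟨0, by omega⟩
  have hfib : ∀ i, (Finset.univ.filter fun v => hα.index (ext v) = i).card ≡ 1 [MOD n - 1] := by
    intro i
    convert card_extensions_modEq hn N (α i) using 3 with v
    have : hα.index (ext v) = i ↔ PrefixOf (α i) (ext v) :=
      ⟨fun h => h ▸ hα.prefixOf_index _, hα.index_eq⟩
    rw [this]
    constructor
    · intro h k hk
      simpa [ext] using (h k hk).symm
    · intro h k hk
      have hkN := hk.trans_le (hN i)
      simpa [ext, hkN] using (h ⟨k, hkN⟩ hk).symm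
  have hcard : n ^ N = ∑ i, (Finset.univ.filter fun v => hα.index (ext v) = i).card := by
    rw [← Finset.card_eq_sum_card_fiberwise fun _ _ => Finset.mem_coe.mpr (Finset.mem_univ _)]
    simp
  have hsum : n ^ N ≡ m [MOD n - 1] := by
    rw [hcard]
    simpa using Nat.ModEq.sum (s := Finset.univ) fun i _ => hfib i
  have hpow : n ^ N ≡ 1 [MOD n - 1] := by
    simpa using card_extensions_modEq hn N []
  exact hsum.symm.trans hpow

end AntichainFam

end PrefixReplacement

/-- Lemma 6.6. Let `T ∈ 𝔓ₙ`, let `h` be a completion of `T`, let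
`g ∈ Vₙ` with maximal antichains `η`, `ν` such that `(η_i δ) g = ν_i δ`.  Then the map
`f` defined by `η_i δ ↦ ν_i (δ)h` is also a completion of `T`. -/
theorem completion_precomposed_with_Vn_is_completion
    {n : ℕ} (hn : 2 ≤ n) (T : Transducer n) [Finite T.Q]
    (hPI : T.PartiallyInvertible)
    (h : Cantor n ≃ₜ Cantor n) (hc : T.IsCompletion h)
    (g : Cantor n ≃ₜ Cantor n) (hg : g ∈ Vn n)
    (l : ℕ) (η ν : Fin l → List (Fin n))
    (hη : AntichainFam η) (hν : AntichainFam ν)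
    (hgact : ∀ (i : Fin l) (δ : Cantor n),
      g (appendInf (η i) δ) = appendInf (ν i) δ) :
    ∃ f : Cantor n ≃ₜ Cantor n,
      (∀ (i : Fin l) (δ : Cantor n),
        f (appendInf (η i) δ) = appendInf (ν i) (h δ)) ∧
      T.IsCompletion f := by
  obtain ⟨k, γ, ρ, p, φ, -, hγ, hφ, hcov, hdisj, hact⟩ := hc
  refine ⟨hη.replaceHomeomorph hν h, fun i δ => hη.replace_appendInf h i δ, l * k,
    fun s => η (finProdFinEquiv.symm s).1 ++ γ (finProdFinEquiv.symm s).2,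
    fun s => ν (finProdFinEquiv.symm s).1 ++ ρ (finProdFinEquiv.symm s).2,
    fun s => p (finProdFinEquiv.symm s).2, fun s => φ (finProdFinEquiv.symm s).2,
    (hη.append hγ).card_modEq_one hn, hη.append hγ, fun s => hφ _, ?_, ?_, ?_⟩
  · refine Set.eq_univ_of_forall fun χ => ?_
    obtain ⟨i, hi, -⟩ := hν χ
    obtain ⟨j, ψ, hψ, e⟩ := Set.mem_iUnion.mp
      (hcov.ge (Set.mem_univ (dropInf (ν i).length χ)))
    refine Set.mem_iUnion.mpr ⟨finProdFinEquiv (i, j), ψ, ?_, ?_⟩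
    · simpa only [Equiv.symm_apply_apply] using hψ
    · simp only [Equiv.symm_apply_apply]
      rw [appendInf_append, e, appendInf_dropInf hi]
  · intro s t hst
    obtain ⟨⟨i, j⟩, rfl⟩ := finProdFinEquiv.surjective s
    obtain ⟨⟨i', j'⟩, rfl⟩ := finProdFinEquiv.surjective t
    simp only [Equiv.symm_apply_apply]
    refine Set.disjoint_left.mpr ?_
    rintro _ ⟨x, hx, rfl⟩ ⟨y, hy, e⟩
    simp only [appendInf_append] at e
    obtain rfl : i = i' := (hν (appendInf (ν i) (appendInf (ρ j) x))).unique
      (prefixOf_appendInf _ _) (e ▸ prefixOf_appendInf _ _)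
    have hj : j ≠ j' := fun hj => hst (by rw [hj])
    exact Set.disjoint_left.mp (hdisj j j' hj) ⟨x, hx, rfl⟩
      ⟨y, hy, appendInf_injective _ e⟩
  · intro s χ
    rw [appendInf_append, appendInf_append, ← hact]
    exact hη.replace_appendInf h _ _
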